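/- Let G be a finite non-abelian p-group such that Aut_l(G) = Inn(G). Then L(G) is cyclic. -/

import Mathlib

/-- The absolute centre `L(G)`: elements fixed by every automorphism of `G`. -/
def absoluteCenter (G : Type*) [Group G] : Subgroup G where
  carrier := {g | ∀ α : MulAut G, α g = g}
  one_mem' := fun α => map_one α
  mul_mem' := fun {a b} ha hb α => by rw [map_mul, ha α, hb α]
  inv_mem' := fun {a} ha α => by rw [map_inv, ha α]

/-- The group `Aut_l(G)` of absolute central automorphisms of `G`. -/
def absCentralAut (G : Type*) [Group G] : Subgroup (MulAut G) where
  carrier := {α | ∀ g : G, g⁻¹ * α g ∈ absoluteCenter G}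
  one_mem' := fun g => by simpa using (absoluteCenter G).one_mem
  mul_mem' := fun {α β} hα hβ g => by
    have h : g⁻¹ * (α * β) g = (g⁻¹ * β g) * ((β g)⁻¹ * α (β g)) := by
      simp [MulAut.mul_apply, mul_assoc]
    rw [h]; exact mul_mem (hβ g) (hα (β g))
  inv_mem' := fun {α} hα g => by
    have h : g⁻¹ * α⁻¹ g = ((α⁻¹ g)⁻¹ * α (α⁻¹ g))⁻¹ := by
      simp [MulAut.inv_def, mul_assoc]
    rw [h]; exact inv_mem (hα (α⁻¹ g))

/-- In a finite commutative `p`-group, if all elements of order dividing `p` are powers of an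
element of maximal order, then the group is cyclic. -/
theorem IsPGroup.isCyclic_of_forall_pow_eq_one_mem_zpowers {p : ℕ} [hp : Fact p.Prime]
    {L : Type*} [CommGroup L] (hL : IsPGroup p L) {c : L}
    (hc : orderOf c = Monoid.exponent L) (hpc : p ∣ orderOf c)
    (hsoc : ∀ y : L, y ^ p = 1 → y ∈ Subgroup.zpowers c) : IsCyclic L := by
  have root : ∀ x : L, x ^ p ∈ Subgroup.zpowers c → x ∈ Subgroup.zpowers c := by
    rintro x ⟨m, hm : c ^ m = x ^ p⟩
    obtain ⟨q, hq⟩ := hpc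
    have hm1 : c ^ (m * q) = 1 := by
      rw [zpow_mul, hm, zpow_natCast, ← pow_mul, ← hq, hc, Monoid.pow_exponent_eq_one]
    have hpm : (p : ℤ) ∣ m := by
      rcases eq_or_ne q 0 with rfl | hq0
      · have hexp : Monoid.exponent L = 0 := by rw [← hc, hq, mul_zero]
        obtain ⟨k, hk⟩ := hL c
        have := orderOf_dvd_of_pow_eq_one hk
        rw [hc, hexp, zero_dvd_iff] at this
        exact absurd this (pow_ne_zero _ hp.out.ne_zero)
      · have := orderOf_dvd_iff_zpow_eq_one.mpr hm1
        rw [hq, Nat.cast_mul] at this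
        exact Int.dvd_of_mul_dvd_mul_right (by exact_mod_cast hq0) this
    obtain ⟨r, rfl⟩ := hpm
    have hroot : (x * (c ^ r)⁻¹) ^ p = 1 := by
      rw [mul_pow, ← hm, inv_pow, ← zpow_natCast, ← zpow_mul, mul_comm r, mul_inv_cancel]
    have := mul_mem (hsoc _ hroot) (Subgroup.zpow_mem_zpowers c r)
    rwa [inv_mul_cancel_right] at this
  have iter : ∀ (k : ℕ) (x : L), x ^ p ^ k = 1 → x ∈ Subgroup.zpowers c := by
    intro k
    induction k with
    | zero => intro x hx; rw [pow_zero, pow_one] at hx; exact hx ▸ one_mem _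
    | succ k ih => intro x hx; exact root x (ih _ (by rw [← pow_mul, ← pow_succ', hx]))
  exact ⟨c, fun x => (hL x).elim fun k hk => iter k x hk⟩

/-- Every element of order dividing `p` is in the image of a homomorphism from a given nontrivial
finite commutative `p`-group. -/
theorem IsPGroup.exists_monoidHom_apply_eq {p : ℕ} [hp : Fact p.Prime] {A L : Type*} [CommGroup A]
    [Finite A] [Nontrivial A] (hA : IsPGroup p A) [Group L] {y : L} (hy : y ^ p = 1) :
    ∃ (f : A →* L) (a : A), f a = y := by
  obtain ⟨n, hn0, hn⟩ := hA.nontrivial_iff_card.mp inferInstance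
  obtain ⟨m, rfl⟩ := Nat.exists_eq_succ_of_ne_zero hn0.ne'
  obtain ⟨K, hK⟩ := Sylow.exists_subgroup_card_pow_prime (G := A) p (n := m)
    (hn ▸ pow_dvd_pow p m.le_succ)
  have hcard : Nat.card (A ⧸ K) = p := by
    have h := K.card_eq_card_quotient_mul_card_subgroup
    rw [hn, hK, pow_succ'] at h
    exact (Nat.eq_of_mul_eq_mul_right (pow_pos hp.out.pos m) h).symm
  have : IsCyclic (A ⧸ K) := isCyclic_of_prime_card hcard
  obtain ⟨g, hg⟩ := IsCyclic.exists_generator (α := A ⧸ K)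
  have hord : orderOf y ∣ orderOf g := by
    rw [orderOf_eq_card_of_forall_mem_zpowers hg, hcard]
    exact orderOf_dvd_of_pow_eq_one hy
  obtain ⟨a, ha⟩ := QuotientGroup.mk'_surjective K g
  exact ⟨(monoidHomOfForallMemZpowers hg hord).comp (QuotientGroup.mk' K), a, by
    rw [MonoidHom.comp_apply, ha, monoidHomOfForallMemZpowers_apply_gen]⟩

theorem IsCyclic.hasEnoughRootsOfUnity {C : Type*} [CommGroup C] [Finite C] [IsCyclic C] {n : ℕ}
    (hn : n ∣ Nat.card C) : HasEnoughRootsOfUnity C n := by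
  have : NeZero (Nat.card C) := ⟨Nat.card_pos.ne'⟩
  have : IsCyclic Cˣ := isCyclic_of_surjective (toUnits (G := C)) toUnits.surjective
  have : HasEnoughRootsOfUnity C (Nat.card C) := by
    obtain ⟨c, hc⟩ := IsCyclic.exists_generator (α := C)
    refine ⟨⟨c, ?_⟩, inferInstance⟩
    rw [← orderOf_eq_card_of_forall_mem_zpowers hc]
    exact IsPrimitiveRoot.orderOf c
  exact HasEnoughRootsOfUnity.of_dvd C hn

/-- If a finite commutative group `A` has at most `|A|` homomorphisms to `L`, then all of them take
values in any given cyclic subgroup of `L` of order divisible by the exponent of `A`. -/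
theorem MonoidHom.apply_mem_zpowers_of_card_le {A L : Type*} [CommGroup A] [Finite A] [Group L]
    [Finite L] {c : L} (hc : Monoid.exponent A ∣ orderOf c)
    (hcard : Nat.card (A →* L) ≤ Nat.card A) (f : A →* L) (a : A) :
    f a ∈ Subgroup.zpowers c := by
  let : CommGroup (Subgroup.zpowers c) := IsCyclic.commGroup
  have : HasEnoughRootsOfUnity (Subgroup.zpowers c) (Monoid.exponent A) :=
    IsCyclic.hasEnoughRootsOfUnity (by rwa [Nat.card_zpowers])
  let Φ : (A →* (Subgroup.zpowers c)ˣ) → (A →* L) := fun φ =>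
    ((Subgroup.zpowers c).subtype.comp (Units.coeHom _)).comp φ
  have hΦ : Function.Injective Φ := fun φ ψ h => by
    ext x
    exact DFunLike.congr_fun h x
  have : Finite (A →* L) := DFunLike.finite _
  have hbij : Function.Bijective Φ := hΦ.bijective_of_nat_card_le <| by
    rwa [CommGroup.card_monoidHom_of_hasEnoughRootsOfUnity]
  obtain ⟨φ, rfl⟩ := hbij.surjective f
  exact (φ a : Subgroup.zpowers c).2

section AbsoluteCenter

variable {G : Type*} [Group G]

theorem absoluteCenter_le_center : absoluteCenter G ≤ Subgroup.center G := fun _ hz =>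
  Subgroup.mem_center_iff.mpr fun g => mul_inv_eq_iff_eq_mul.mp (hz (MulAut.conj g))

/-- The absolute central automorphism `g ↦ g * f g` attached to a homomorphism from `G` to `L(G)`
that is trivial on the centre. -/
noncomputable def MonoidHom.mulAutOfCenterQuotient [Finite G]
    (f : G ⧸ Subgroup.center G →* absoluteCenter G) : MulAut G :=
  let α : G →* G :=
    { toFun g := g * f g
      map_one' := by simp
      map_mul' a b := by
        have hcomm := Subgroup.mem_center_iff.mp (absoluteCenter_le_center (f a).2) b
        simp only [QuotientGroup.mk_mul, map_mul, Subgroup.coe_mul]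
        rw [mul_assoc a b, ← mul_assoc b, hcomm]
        simp only [mul_assoc] }
  MulEquiv.ofBijective α <| Finite.injective_iff_bijective.mp <|
    (injective_iff_map_eq_one α).mpr fun g (hg : g * f g = 1) => by
      have hmem : g ∈ Subgroup.center G := by
        rw [eq_inv_of_mul_eq_one_left hg]
        exact inv_mem (absoluteCenter_le_center (f g).2)
      rwa [(QuotientGroup.eq_one_iff g).mpr hmem, map_one, Subgroup.coe_one, mul_one] at hg

theorem MonoidHom.mulAutOfCenterQuotient_apply [Finite G]
    (f : G ⧸ Subgroup.center G →* absoluteCenter G) (g : G) :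
    f.mulAutOfCenterQuotient g = g * f g := rfl

/-- If every absolute central automorphism is inner, then there are at most `|G / Z(G)|`
homomorphisms from `G / Z(G)` to `L(G)`. -/
theorem card_monoidHom_absoluteCenter_le [Finite G]
    (h : absCentralAut G ≤ (MulAut.conj : G →* MulAut G).range) :
    Nat.card (G ⧸ Subgroup.center G →* absoluteCenter G) ≤ Nat.card (G ⧸ Subgroup.center G) := by
  have hinner (f : G ⧸ Subgroup.center G →* absoluteCenter G) :
      ∃ x : G, MulAut.conj x = f.mulAutOfCenterQuotient :=
    h fun g => by simp [MonoidHom.mulAutOfCenterQuotient_apply]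
  choose x hx using hinner
  refine Nat.card_le_card_of_injective (fun f => (x f : G ⧸ Subgroup.center G)) fun f₁ f₂ h₁₂ => ?_
  have hz : (x f₁)⁻¹ * x f₂ ∈ Subgroup.center G := QuotientGroup.eq.mp h₁₂
  have hconj : MulAut.conj (x f₁) = MulAut.conj (x f₂) := by
    rw [← inv_mul_eq_one, ← map_inv, ← map_mul]
    ext g
    rw [MulAut.conj_apply, ← Subgroup.mem_center_iff.mp hz g, mul_inv_cancel_right,
      MulAut.one_apply]
  ext g
  have := DFunLike.congr_fun ((hx f₁).symm.trans (hconj.trans (hx f₂))) g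
  simpa [MonoidHom.mulAutOfCenterQuotient_apply] using this

theorem inv_mul_conj_mem_absoluteCenter (h : (MulAut.conj : G →* MulAut G).range ≤ absCentralAut G)
    (x g : G) : g⁻¹ * (x * g * x⁻¹) ∈ absoluteCenter G :=
  h ⟨x, rfl⟩ g

theorem pow_exponent_absoluteCenter_mem_center
    (h : (MulAut.conj : G →* MulAut G).range ≤ absCentralAut G) (g : G) :
    g ^ Monoid.exponent (absoluteCenter G) ∈ Subgroup.center G := by
  refine Subgroup.mem_center_iff.mpr fun x => mul_inv_eq_iff_eq_mul.mp ?_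
  have hl := inv_mul_conj_mem_absoluteCenter h x g
  have hcomm : Commute g (g⁻¹ * (x * g * x⁻¹)) :=
    Subgroup.mem_center_iff.mp (absoluteCenter_le_center hl) g
  have hpow := congrArg Subtype.val (Monoid.pow_exponent_eq_one (⟨_, hl⟩ : absoluteCenter G))
  rw [← conj_pow, ← mul_inv_cancel_left g (x * g * x⁻¹), hcomm.mul_pow]
  simpa using hpow

theorem mul_comm_quotient_center (h : (MulAut.conj : G →* MulAut G).range ≤ absCentralAut G)
    (a b : G ⧸ Subgroup.center G) : a * b = b * a := by
  induction a using QuotientGroup.induction_on with | H x =>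
  induction b using QuotientGroup.induction_on with | H g =>
  have := (QuotientGroup.eq_one_iff _).mpr
    (absoluteCenter_le_center (inv_mul_conj_mem_absoluteCenter h x g))
  rwa [QuotientGroup.mk_mul, QuotientGroup.mk_inv, inv_mul_eq_one, QuotientGroup.mk_mul,
    QuotientGroup.mk_inv, eq_mul_inv_iff_mul_eq, QuotientGroup.mk_mul, eq_comm] at this

end AbsoluteCenter

/-- Let `G` be a finite non-abelian `p`-group with `Aut_l(G) = Inn(G)`.
Then `L(G)` is cyclic. -/
theorem absoluteCenter_isCyclic {p : ℕ} [Fact p.Prime] (G : Type*) [Group G] [Finite G]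
    (hG : IsPGroup p G) (hna : ∃ a b : G, a * b ≠ b * a)
    (h : absCentralAut G = (MulAut.conj : G →* MulAut G).range) :
    IsCyclic (absoluteCenter G) := by
  have hL : IsPGroup p (absoluteCenter G) := hG.to_subgroup _
  let : CommGroup (absoluteCenter G) :=
    { mul_comm a b := Subtype.ext (Subgroup.mem_center_iff.mp (absoluteCenter_le_center b.2) a) }
  let : CommGroup (G ⧸ Subgroup.center G) := { mul_comm := mul_comm_quotient_center h.ge }
  obtain ⟨c, hc⟩ := Monoid.exists_orderOf_eq_exponent
    (Monoid.ExponentExists.of_finite (G := absoluteCenter G))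
  have : Nontrivial (G ⧸ Subgroup.center G) := by
    obtain ⟨a, b, hab⟩ := hna
    refine QuotientGroup.nontrivial_iff.mpr fun htop => hab ?_
    exact Subgroup.mem_center_iff.mp (htop ▸ Subgroup.mem_top b) a
  have hexp : Monoid.exponent (G ⧸ Subgroup.center G) ∣ orderOf c := by
    rw [hc]
    refine Monoid.exponent_dvd_of_forall_pow_eq_one fun a => ?_
    induction a using QuotientGroup.induction_on with | H g =>
    exact (QuotientGroup.eq_one_iff _).mpr (pow_exponent_absoluteCenter_mem_center h.ge g)
  have hA : IsPGroup p (G ⧸ Subgroup.center G) := hG.to_quotient _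
  have hpexp : p ∣ Monoid.exponent (G ⧸ Subgroup.center G) := by
    obtain ⟨n, hn0, hn⟩ := hA.nontrivial_iff_card.mp inferInstance
    obtain ⟨a, ha⟩ := exists_prime_orderOf_dvd_card' p (hn ▸ dvd_pow_self p hn0.ne')
    exact ha ▸ Monoid.order_dvd_exponent a
  refine hL.isCyclic_of_forall_pow_eq_one_mem_zpowers hc (hpexp.trans hexp) fun y hy => ?_
  obtain ⟨f, a, rfl⟩ := hA.exists_monoidHom_apply_eq hy
  exact MonoidHom.apply_mem_zpowers_of_card_le hexp (card_monoidHom_absoluteCenter_le h.le) f a
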